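/- arXiv:1810.07715 — 3 statements merged into one kernel-verified Lean document; each statement's English description precedes it below -/
import Mathlib

section
/- Let α be an element of an algebraic closure of F_q and let g ∈ F_q[x] have degree D ≥ 2 such that g is not of the form a·x^{p^h} + b (a, b ∈ F_q) and not of the form a(x − α)^D + α. Let G ∈ F_q[x] be the p-reduction of g, d = deg G > 1, and write D = d·p^h with h ≥ 0. Then there exist a positive integer i and an element γ in the algebraic closure such that g^{(i)}(γ) = α and ν(g^{(n)}(x) − γ) = p^{n·h} for every n ≥ 0. In particular, there exists a real constant C > 0 such that C·d^n ≤ Δ(g^{(n)}(x) − α) ≤ d^n for all n ≥ 0. -/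
open Polynomial UniqueFactorizationMonoid
open scoped Classical

/-- The `n`-th compositional iterate of a polynomial `g`. -/
noncomputable def iterPoly {K : Type*} [CommSemiring K] (g : Polynomial K) : ℕ → Polynomial K
  | 0 => X
  | n + 1 => g.comp (iterPoly g n)

/-- `P_n[f,g] = f(g^{(n)})`. -/
noncomputable def Pn {K : Type*} [CommSemiring K] (f g : Polynomial K) (n : ℕ) : Polynomial K :=
  f.comp (iterPoly g n)

/-- The finset of (normalized) monic irreducible factors of `P`. -/
noncomputable def irrFactors {K : Type*} [Field K] (P : Polynomial K) : Finset (Polynomial K) :=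
  (normalizedFactors P).toFinset

/-- Number of distinct irreducible factors of `P`. -/
noncomputable def Nfac {K : Type*} [Field K] (P : Polynomial K) : ℕ := (irrFactors P).card

/-- Degree of the squarefree part of `P`. -/
noncomputable def Dfac {K : Type*} [Field K] (P : Polynomial K) : ℕ :=
  ∑ r ∈ irrFactors P, r.natDegree

/-- Largest degree of an irreducible factor of `P`. -/
noncomputable def Mfac {K : Type*} [Field K] (P : Polynomial K) : ℕ :=
  (irrFactors P).sup natDegree

/-- Smallest degree of an irreducible factor of `P`. -/
noncomputable def mfac {K : Type*} [Field K] (P : Polynomial K) : ℕ :=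
  sInf {d | ∃ r ∈ irrFactors P, r.natDegree = d}

/-- Largest multiplicity in the irreducible factorization of `P`. -/
noncomputable def Efac {K : Type*} [Field K] (P : Polynomial K) : ℕ :=
  (irrFactors P).sup fun r => (normalizedFactors P).count r

/-- Smallest multiplicity in the irreducible factorization of `P`. -/
noncomputable def efac {K : Type*} [Field K] (P : Polynomial K) : ℕ :=
  sInf {e | ∃ r ∈ irrFactors P, (normalizedFactors P).count r = e}

/-- Largest multiplicity of a root of `P` in an algebraic closure. -/
noncomputable def nuMax {K : Type*} [Field K] (P : Polynomial K) : ℕ :=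
  Efac (P.map (algebraMap K (AlgebraicClosure K)))

/-- Smallest multiplicity of a root of `P` in an algebraic closure. -/
noncomputable def nuMin {K : Type*} [Field K] (P : Polynomial K) : ℕ :=
  efac (P.map (algebraMap K (AlgebraicClosure K)))

/-- The pair `(f, g)` is `p`-critical: `g = a x^{p^h} + b`. -/
def IsPCritical {K : Type*} [Field K] (p : ℕ) (_f g : Polynomial K) : Prop :=
  ∃ (h : ℕ) (a b : K), g = C a * X ^ p ^ h + C b

/-- The pair `(f, g)` is critical: `f = β (x-α)^{deg f}` and `g = γ (x-α)^{deg g} + α`. -/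
def IsCritical {K : Type*} [Field K] (f g : Polynomial K) : Prop :=
  ∃ α β γ : K, f = C β * (X - C α) ^ f.natDegree ∧
    g = C γ * (X - C α) ^ g.natDegree + C α

section IterateLemmas

variable {L : Type*} [Field L]

theorem iterPoly_map {K : Type*} [Field K] (φ : K →+* L) (g : Polynomial K) (n : ℕ) :
    (iterPoly g n).map φ = iterPoly (g.map φ) n := by
  induction n with
  | zero => simp [iterPoly]
  | succ n ih => simp [iterPoly, Polynomial.map_comp, ih]

theorem eval_iterPoly (f : Polynomial L) (n : ℕ) (x : L) :
    (iterPoly f n).eval x = (fun y => f.eval y)^[n] x := by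
  induction n with
  | zero => simp [iterPoly]
  | succ n ih => rw [Function.iterate_succ_apply', ← ih, iterPoly, eval_comp]

theorem natDegree_iterPoly (f : Polynomial L) (n : ℕ) :
    (iterPoly f n).natDegree = f.natDegree ^ n := by
  induction n with
  | zero => simp [iterPoly]
  | succ n ih => rw [iterPoly, natDegree_comp, ih, pow_succ']

theorem iterPoly_sub_C_ne_zero (f : Polynomial L) (hf : 0 < f.natDegree) (n : ℕ) (a : L) :
    iterPoly f n - C a ≠ 0 := by
  intro h0
  have := congrArg natDegree h0
  rw [natDegree_sub_C, natDegree_iterPoly, natDegree_zero] at this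
  exact (pow_pos hf n).ne' this

theorem normalizedFactors_eq_map_roots [IsAlgClosed L] (P : Polynomial L) :
    normalizedFactors P = P.roots.map (fun a => X - C a) := by
  by_cases hP : P = 0
  · simp [hP]
  have hsplit := (IsAlgClosed.splits P).eq_prod_roots
  have hassoc : Associated P (P.roots.map (fun a => X - C a)).prod := by
    conv_lhs => rw [hsplit]
    exact associated_unit_mul_left _ _ (isUnit_C.2 (by simpa using hP))
  have h1 : normalizedFactors P =
      normalizedFactors (P.roots.map (fun a => X - C a)).prod :=
    (associated_iff_normalizedFactors_eq_normalizedFactors hP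
      (hassoc.ne_zero_iff.1 hP)).1 hassoc
  rw [h1, normalizedFactors_prod_eq, Multiset.map_map]
  · refine Multiset.map_congr rfl fun a _ => ?_
    simpa using (monic_X_sub_C a).normalize_eq_self
  · intro q hq
    obtain ⟨a, -, rfl⟩ := Multiset.mem_map.1 hq
    exact irreducible_X_sub_C a

theorem X_sub_C_injective : Function.Injective (fun a : L => X - C a) := fun _ _ hab =>
  C_injective (sub_right_injective hab)

theorem irrFactors_eq_image_roots [IsAlgClosed L] (P : Polynomial L) :
    irrFactors P = P.roots.toFinset.image (fun a => X - C a) := by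
  ext q
  simp [irrFactors, normalizedFactors_eq_map_roots]

theorem Dfac_eq_card_roots [IsAlgClosed L] (P : Polynomial L) :
    Dfac P = P.roots.toFinset.card := by
  rw [Dfac, irrFactors_eq_image_roots, Finset.sum_image (X_sub_C_injective.injOn)]
  simp

theorem Efac_eq_sup_rootMultiplicity [IsAlgClosed L] (P : Polynomial L) :
    Efac P = P.roots.toFinset.sup (fun a => P.rootMultiplicity a) := by
  rw [Efac, irrFactors_eq_image_roots, Finset.sup_image]
  refine Finset.sup_congr rfl fun a _ => ?_
  rw [Function.comp_apply, normalizedFactors_eq_map_roots,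
    Multiset.count_map_eq_count' _ _ X_sub_C_injective, count_roots]

theorem mem_roots_iterPoly_sub_C (f : Polynomial L) (hf : 0 < f.natDegree) (n : ℕ) (a x : L) :
    x ∈ (iterPoly f n - C a).roots.toFinset ↔ (fun y => f.eval y)^[n] x = a := by
  rw [Multiset.mem_toFinset, mem_roots (iterPoly_sub_C_ne_zero f hf n a), IsRoot, eval_sub,
    eval_C, eval_iterPoly, sub_eq_zero]

theorem sub_C_eval_eq_mul (F : Polynomial L) (x : L) (hx : (derivative F).eval x ≠ 0) :
    ∃ W : Polynomial L, F - C (F.eval x) = (X - C x) * W ∧ W.eval x ≠ 0 := by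
  obtain ⟨W, hW⟩ := X_sub_C_dvd_sub_C_eval (a := x) (p := F)
  refine ⟨W, hW, ?_⟩
  have := congrArg (fun q => (derivative q).eval x) hW
  simp [derivative_mul] at this
  rwa [← this]

theorem iterPoly_sub_C_eq_pow_mul {p : ℕ} [Fact p.Prime] [CharP L p] (F : Polynomial L) (h : ℕ)
    (x : L) (n : ℕ)
    (hx : ∀ j < n, (derivative F).eval ((fun y => (F ^ p ^ h).eval y)^[j] x) ≠ 0) :
    ∃ U : Polynomial L, iterPoly (F ^ p ^ h) n - C ((fun y => (F ^ p ^ h).eval y)^[n] x) =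
      (X - C x) ^ p ^ (n * h) * U ∧ U.eval x ≠ 0 := by
  induction n with
  | zero => exact ⟨1, by simp [iterPoly], by simp⟩
  | succ n ih =>
    obtain ⟨U, hU, hU0⟩ := ih fun j hj => hx j (by omega)
    rw [Function.iterate_succ_apply']
    set δ := (fun y => (F ^ p ^ h).eval y)^[n] x with hδ
    obtain ⟨W, hW, hW0⟩ := sub_C_eval_eq_mul F δ (hx n (by omega))
    refine ⟨U ^ p ^ h * (W ^ p ^ h).comp (iterPoly (F ^ p ^ h) n), ?_, ?_⟩
    · have h1 : F ^ p ^ h - C ((F ^ p ^ h).eval δ) = ((X - C δ) * W) ^ p ^ h := by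
        rw [← hW, sub_pow_char_pow, eval_pow, C_pow]
      have h2 := congrArg (fun q => q.comp (iterPoly (F ^ p ^ h) n)) h1
      simp only [sub_comp, C_comp, pow_comp, mul_comp, X_comp] at h2
      rw [hU] at h2
      rw [iterPoly, pow_comp, h2, pow_comp]
      ring
    · rw [eval_mul, eval_pow, eval_comp, eval_iterPoly, ← hδ, eval_pow]
      exact mul_ne_zero (pow_ne_zero _ hU0) (pow_ne_zero _ hW0)

theorem rootMultiplicity_iterPoly_sub_C {p : ℕ} [Fact p.Prime] [CharP L p] (F : Polynomial L)
    (h : ℕ) (x : L) (n : ℕ)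
    (hx : ∀ j < n, (derivative F).eval ((fun y => (F ^ p ^ h).eval y)^[j] x) ≠ 0) :
    (iterPoly (F ^ p ^ h) n -
      C ((fun y => (F ^ p ^ h).eval y)^[n] x)).rootMultiplicity x = p ^ (n * h) := by
  obtain ⟨U, hU, hU0⟩ := iterPoly_sub_C_eq_pow_mul F h x n hx
  have hUne : U ≠ 0 := by rintro rfl; simp at hU0
  rw [hU, mul_comm, rootMultiplicity_mul_X_sub_C_pow hUne, rootMultiplicity_eq_zero hU0, zero_add]

theorem exists_iterate_eq [IsAlgClosed L] (f : Polynomial L) (hf : 0 < f.natDegree) (n : ℕ)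
    (a : L) : ∃ x, (fun y => f.eval y)^[n] x = a := by
  have hsurj : Function.Surjective (fun y => f.eval y) := fun b => by
    obtain ⟨x, hx⟩ := IsAlgClosed.exists_root (f - C b) (by
      rw [degree_sub_C (natDegree_pos_iff_degree_pos.1 hf)]
      exact (natDegree_pos_iff_degree_pos.1 hf).ne')
    exact ⟨x, by simpa [sub_eq_zero] using hx⟩
  exact hsurj.iterate n a

/-- If no critical point of `F` eventually maps to `γ`, every root of `f^{(n)} - γ` has
multiplicity `p ^ (n * h)`, where `f = F ^ p ^ h`. -/
theorem Efac_Dfac_of_not_postcritical [IsAlgClosed L] {p : ℕ} [Fact p.Prime] [CharP L p]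
    (F : Polynomial L) (hF : 0 < F.natDegree) (h : ℕ) (γ : L)
    (hγ : ∀ c n, (derivative F).eval c = 0 → (fun y => (F ^ p ^ h).eval y)^[n] c ≠ γ) (n : ℕ) :
    Efac (iterPoly (F ^ p ^ h) n - C γ) = p ^ (n * h) ∧
      Dfac (iterPoly (F ^ p ^ h) n - C γ) = F.natDegree ^ n := by
  have hp : 0 < p := (Fact.out : p.Prime).pos
  have hf : 0 < (F ^ p ^ h).natDegree := by
    rw [natDegree_pow]; positivity
  set P := iterPoly (F ^ p ^ h) n - C γ with hP
  have hmult : ∀ x ∈ P.roots.toFinset, P.rootMultiplicity x = p ^ (n * h) := by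
    intro x hx
    rw [hP, mem_roots_iterPoly_sub_C _ hf] at hx
    rw [hP, ← hx]
    refine rootMultiplicity_iterPoly_sub_C F h x n fun j hj h0 => hγ _ (n - j) h0 ?_
    rw [← Function.iterate_add_apply, Nat.sub_add_cancel hj.le, hx]
  obtain ⟨x, hx⟩ := exists_iterate_eq _ hf n γ
  rw [← mem_roots_iterPoly_sub_C _ hf, ← hP] at hx
  constructor
  · rw [Efac_eq_sup_rootMultiplicity, Finset.sup_congr rfl hmult, Finset.sup_const ⟨x, hx⟩]
  · rw [Dfac_eq_card_roots]
    have hcard : P.roots.card = P.natDegree :=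
      (splits_iff_card_roots.1 (IsAlgClosed.splits P))
    rw [← Multiset.toFinset_sum_count_eq, Finset.sum_congr rfl
      (fun a ha => (count_roots P).trans (hmult a ha)), Finset.sum_const, smul_eq_mul, hP,
      natDegree_sub_C, natDegree_iterPoly, natDegree_pow, mul_pow, ← pow_mul, mul_comm h n,
      mul_comm (p ^ (n * h))] at hcard
    exact Nat.eq_of_mul_eq_mul_right (by positivity) hcard

theorem Dfac_iterPoly_sub_C_le [IsAlgClosed L] {p : ℕ} [Fact p.Prime] [CharP L p]
    (F : Polynomial L) (hF : 0 < F.natDegree) (h : ℕ) (a : L) (n : ℕ) :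
    Dfac (iterPoly (F ^ p ^ h) n - C a) ≤ F.natDegree ^ n := by
  have hp : 0 < p := (Fact.out : p.Prime).pos
  have hf : 0 < (F ^ p ^ h).natDegree := by
    rw [natDegree_pow]; positivity
  rw [Dfac_eq_card_roots]
  induction n with
  | zero => simp [iterPoly]
  | succ n ih =>
    set f := F ^ p ^ h with hfdef
    have hmaps : ∀ x ∈ (iterPoly f (n + 1) - C a).roots.toFinset,
        f.eval x ∈ (iterPoly f n - C a).roots.toFinset := by
      intro x hx
      rw [mem_roots_iterPoly_sub_C _ hf, Function.iterate_succ_apply] at hx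
      rwa [mem_roots_iterPoly_sub_C _ hf]
    refine (Finset.card_le_mul_card_image_of_maps_to hmaps F.natDegree fun b _ => ?_).trans
      (by rw [pow_succ']; exact Nat.mul_le_mul_left _ ih)
    rcases Finset.eq_empty_or_nonempty
      {x ∈ (iterPoly f (n + 1) - C a).roots.toFinset | f.eval x = b} with h0 | ⟨x₀, hx₀⟩
    · rw [h0]; simp
    have hne : F - C (F.eval x₀) ≠ 0 := fun h0 => by
      have := congrArg natDegree h0
      rw [natDegree_sub_C, natDegree_zero] at this
      omega
    refine (Finset.card_le_card (t := (F - C (F.eval x₀)).roots.toFinset) fun x hx => ?_).trans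
      ((Multiset.toFinset_card_le _).trans ((card_roots' _).trans (natDegree_sub_C).le))
    have hxx : f.eval x = f.eval x₀ :=
      (Finset.mem_filter.1 hx).2.trans (Finset.mem_filter.1 hx₀).2.symm
    rw [hfdef, eval_pow, eval_pow] at hxx
    have : F.eval x = F.eval x₀ := iterateFrobenius_inj L p h (by
      simpa [iterateFrobenius_def] using hxx)
    rw [Multiset.mem_toFinset, mem_roots hne]
    simp [this]

theorem sub_C_eval_eq_C_mul_pow [IsAlgClosed L] (F : Polynomial L) (b : L)
    (hb : ∀ x, F.eval x = F.eval b → x = b) :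
    F - C (F.eval b) = C F.leadingCoeff * (X - C b) ^ F.natDegree ∨ F.natDegree = 0 := by
  by_cases hF : F.natDegree = 0
  · exact Or.inr hF
  left
  set P := F - C (F.eval b) with hP
  have hdeg : P.natDegree = F.natDegree := natDegree_sub_C
  have hP0 : P ≠ 0 := fun h0 => hF (by rw [← hdeg, h0, natDegree_zero])
  have hlc : P.leadingCoeff = F.leadingCoeff :=
    leadingCoeff_sub_of_degree_lt (degree_C_le.trans_lt
      (natDegree_pos_iff_degree_pos.1 (Nat.pos_of_ne_zero hF)))
  have hcard : P.roots.card = F.natDegree :=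
    (splits_iff_card_roots.1 (IsAlgClosed.splits P)).trans hdeg
  have hroots : P.roots = Multiset.replicate F.natDegree b := by
    refine Multiset.eq_replicate.2 ⟨hcard, fun x hx => hb x ?_⟩
    rw [mem_roots hP0] at hx
    simpa [hP, sub_eq_zero] using hx
  have := (IsAlgClosed.splits P).eq_prod_roots
  rw [hroots, hlc, Multiset.map_replicate, Multiset.prod_replicate] at this
  exact this

/-- The backward orbit of `α` is infinite unless `α` is totally ramified and fixed. -/
theorem infinite_backward_orbit [IsAlgClosed L] {p : ℕ} [Fact p.Prime] [CharP L p]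
    (F : Polynomial L) (hF : 1 < F.natDegree) (hF' : derivative F ≠ 0) (h : ℕ) (α : L)
    (hform : ¬ ∃ a : L, F ^ p ^ h = C a * (X - C α) ^ (F.natDegree * p ^ h) + C α) :
    {b : L | ∃ n, (fun y => (F ^ p ^ h).eval y)^[n] b = α}.Infinite := by
  have hp : 0 < p := (Fact.out : p.Prime).pos
  have hf : 0 < (F ^ p ^ h).natDegree := by
    rw [natDegree_pow]; positivity
  set φ : L → L := fun y => (F ^ p ^ h).eval y with hφ
  set B : Set L := {b : L | ∃ n, φ^[n] b = α} with hB
  intro hfin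
  have hBα : α ∈ B := ⟨0, rfl⟩
  have hback : ∀ x, φ x ∈ B → x ∈ B := fun x ⟨n, hn⟩ => ⟨n + 1, by
    rwa [Function.iterate_succ_apply]⟩
  choose s hs using exists_iterate_eq (F ^ p ^ h) hf 1
  have hs' : ∀ b, φ (s b) = b := hs
  have hsB : ∀ b ∈ B, s b ∈ B := fun b hb => hback _ (by rwa [hs'])
  have : Finite B := hfin
  let t : B → B := fun b => ⟨s b, hsB b b.2⟩
  have ht : Function.Injective t := fun b c hbc => Subtype.ext (by
    rw [← hs' b, ← hs' c]; exact congrArg φ (congrArg Subtype.val hbc))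
  have htsurj : ∀ x ∈ B, ∃ b ∈ B, s b = x := fun x hx => by
    obtain ⟨b, hb⟩ := Finite.injective_iff_surjective.1 ht ⟨x, hx⟩
    exact ⟨b, b.2, congrArg Subtype.val hb⟩
  have hinj : ∀ b ∈ B, ∀ x, F.eval x = F.eval b → x = b := by
    intro b hb x hx
    obtain ⟨c, hc, rfl⟩ := htsurj b hb
    have hxc : φ x = c := by
      rw [← hs' c]
      simp only [hφ, eval_pow, hx]
    obtain ⟨e, he, rfl⟩ := htsurj x (hback x (by rwa [hxc]))
    rw [← hxc, hs']
  have hshape : ∀ b ∈ B,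
      F - C (F.eval b) = C F.leadingCoeff * (X - C b) ^ F.natDegree := fun b hb =>
    (sub_C_eval_eq_C_mul_pow F b (hinj b hb)).resolve_right (by omega)
  have hder : ∀ b ∈ B, derivative F =
      C F.leadingCoeff * (C (F.natDegree : L) * (X - C b) ^ (F.natDegree - 1)) := by
    intro b hb
    have := congrArg derivative (hshape b hb)
    simpa [derivative_X_sub_C_pow] using this
  have huniq : ∀ b ∈ B, b = α := by
    intro b hb
    have h1 : (derivative F).eval b = 0 := by
      rw [hder b hb]
      simp [show F.natDegree - 1 ≠ 0 by omega]
    have h2 := hder α hBα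
    rw [h2] at h1
    have hc : F.leadingCoeff ≠ 0 := fun h0 => hF' (by rw [h2, h0]; simp)
    have hd : (F.natDegree : L) ≠ 0 := fun h0 => hF' (by rw [h2, h0]; simp)
    rw [eval_mul, eval_mul, eval_C, eval_C, eval_pow, eval_sub, eval_X, eval_C] at h1
    have := (pow_eq_zero_iff (n := F.natDegree - 1) (by omega)).1
      ((mul_eq_zero.1 ((mul_eq_zero.1 h1).resolve_left hc)).resolve_left hd)
    exact sub_eq_zero.1 this
  have hfix : (F.eval α) ^ p ^ h = α := by
    have := hs' α
    rw [huniq _ (hsB α hBα)] at this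
    simpa only [hφ, eval_pow] using this
  refine hform ⟨F.leadingCoeff ^ p ^ h, ?_⟩
  have h3 : (F - C (F.eval α)) ^ p ^ h = F ^ p ^ h - C α := by
    rw [sub_pow_char_pow, ← C_pow, hfix]
  rw [hshape α hBα, mul_pow, ← C_pow, ← pow_mul] at h3
  rw [h3, sub_add_cancel]

theorem finite_forward_orbit {K : Type*} [Field K] [Finite K] [Algebra K L]
    [Algebra.IsAlgebraic K L] (g : Polynomial K) (c : L) :
    (Set.range fun n => (fun y => (g.map (algebraMap K L)).eval y)^[n] c).Finite := by
  have : FiniteDimensional K (IntermediateField.adjoin K {c}) :=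
    IntermediateField.adjoin.finiteDimensional (Algebra.IsIntegral.isIntegral c)
  have : Finite (IntermediateField.adjoin K {c}) := Module.finite_of_finite K
  refine Set.Finite.subset
    (Set.toFinite ((IntermediateField.adjoin K {c} : IntermediateField K L) : Set L)) ?_
  rintro _ ⟨n, rfl⟩
  beta_reduce
  rw [← eval_iterPoly, ← iterPoly_map, eval_map_algebraMap]
  exact IntermediateField.algebra_adjoin_le_adjoin K {c} (aeval_mem_adjoin_singleton K c)

end IterateLemmas

theorem stmt15 {K : Type*} [Field K] [Fintype K] {p : ℕ} [Fact p.Prime] [CharP K p]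
    (g G : Polynomial K) (h D d : ℕ)
    (hgD : g.natDegree = D) (hD : 2 ≤ D)
    (α : AlgebraicClosure K)
    (hform1 : ¬ ∃ (a b : K) (m : ℕ), g = C a * X ^ p ^ m + C b)
    (hform2 : ¬ ∃ a : AlgebraicClosure K,
      g.map (algebraMap K (AlgebraicClosure K)) = C a * (X - C α) ^ D + C α)
    (hred : g = G ^ p ^ h) (hG : derivative G ≠ 0)
    (hd : G.natDegree = d) (hd1 : 1 < d) (hDd : D = d * p ^ h) :
    (∃ (i : ℕ) (γ : AlgebraicClosure K), 1 ≤ i ∧ aeval γ (iterPoly g i) = α ∧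
      ∀ n : ℕ,
        Efac ((iterPoly g n).map (algebraMap K (AlgebraicClosure K)) - C γ) = p ^ (n * h)) ∧
    ∃ c : ℝ, 0 < c ∧ ∀ n : ℕ,
      c * (d : ℝ) ^ n ≤
        (Dfac ((iterPoly g n).map (algebraMap K (AlgebraicClosure K)) - C α) : ℝ) ∧
      (Dfac ((iterPoly g n).map (algebraMap K (AlgebraicClosure K)) - C α) : ℝ) ≤
        (d : ℝ) ^ n := by
  have hp : 0 < p := (Fact.out : p.Prime).pos
  have : CharP (AlgebraicClosure K) p := charP_of_injective_algebraMap
    (algebraMap K (AlgebraicClosure K)).injective p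
  set φ := algebraMap K (AlgebraicClosure K) with hφ
  set F := G.map φ with hF
  have hFd : F.natDegree = d := by rw [hF, natDegree_map, hd]
  have hF' : derivative F ≠ 0 := by
    rw [hF, derivative_map]
    exact (Polynomial.map_ne_zero_iff φ.injective).2 hG
  have hgF : g.map φ = F ^ p ^ h := by rw [hred, Polynomial.map_pow]
  have hf : 0 < (F ^ p ^ h).natDegree := by rw [natDegree_pow, hFd]; positivity
  have hinf := infinite_backward_orbit (p := p) F (by omega) hF' h α (by
    rwa [← hgF, hFd, ← hDd])
  have hfin : (insert α (⋃ c ∈ {c | (derivative F).eval c = 0},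
      Set.range fun n => (fun y => (F ^ p ^ h).eval y)^[n] c)).Finite := by
    refine Set.Finite.insert _ (Set.Finite.biUnion ?_ fun c _ => ?_)
    · exact (derivative F).finite_setOfPred_isRoot hF'
    · rw [← hgF]
      exact finite_forward_orbit g c
  obtain ⟨γ, ⟨i, hi⟩, hγ⟩ := hinf.exists_notMem_finite hfin
  have hγα : γ ≠ α := fun h0 => hγ (h0 ▸ Set.mem_insert _ _)
  have hcrit : ∀ c n, (derivative F).eval c = 0 →
      (fun y => (F ^ p ^ h).eval y)^[n] c ≠ γ := fun c n hc h0 =>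
    hγ (Set.mem_insert_of_mem _ (Set.mem_biUnion hc ⟨n, h0⟩))
  have hmain := Efac_Dfac_of_not_postcritical F (by omega) h γ hcrit
  simp only [iterPoly_map, hgF]
  have hd0 : (0 : ℝ) < d := by positivity
  refine ⟨⟨i, γ, ?_, ?_, fun n => (hmain n).1⟩, ((d : ℝ) ^ i)⁻¹, by positivity, fun n => ⟨?_, ?_⟩⟩
  · rcases Nat.eq_zero_or_pos i with rfl | hi0
    · exact absurd hi hγα
    · exact hi0
  · rw [← hi, ← hgF, ← eval_iterPoly, ← iterPoly_map, eval_map_algebraMap]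
  · rw [inv_mul_le_iff₀ (by positivity), Dfac_eq_card_roots]
    norm_cast
    rcases le_total i n with hin | hin
    · have h1 := (hmain (n - i)).2
      rw [Dfac_eq_card_roots, hFd] at h1
      rw [← Nat.add_sub_cancel' hin, pow_add, ← h1, Nat.add_sub_cancel' hin]
      refine Nat.mul_le_mul_left _ (Finset.card_le_card fun x hx => ?_)
      rw [mem_roots_iterPoly_sub_C _ hf] at hx ⊢
      rw [← Nat.add_sub_cancel' hin, Function.iterate_add_apply, hx, hi]
    · obtain ⟨x, hx⟩ := exists_iterate_eq _ hf n α
      rw [← mem_roots_iterPoly_sub_C _ hf] at hx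
      exact (Nat.pow_le_pow_right (by omega) hin).trans
        (Nat.le_mul_of_pos_right _ (Finset.card_pos.2 ⟨x, hx⟩))
  · have := Dfac_iterPoly_sub_C_le (p := p) F (by omega) h α n
    rw [hFd] at this
    exact_mod_cast this
end

section
/- Let f ∈ F_q[x] be an irreducible polynomial of degree k ≥ 1 and let α be a root of f in the field with q^k elements. Let g ∈ F_q[x] be any polynomial of degree D ≥ 1. Then the following are equivalent: (i) there exists a constant c > 0 such that m_{f,g}(n) ≤ c for all n ≥ 0; (ii) the sequence (m_{f,g}(n))_{n≥0} is eventually constant; (iii) α is g-periodic, i.e., g^{(i)}(α) = α for some i ≥ 1; (iv) m_{f,g}(n) = k for all n ≥ 0. -/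
open Polynomial UniqueFactorizationMonoid
open scoped Classical

theorem aeval_iterPoly {K E : Type*} [CommSemiring K] [CommSemiring E] [Algebra K E]
    (g : Polynomial K) (n : ℕ) (x : E) :
    aeval x (iterPoly g n) = (fun y => aeval y g)^[n] x := by
  induction n with
  | zero => simp [iterPoly]
  | succ n ih => rw [iterPoly, aeval_comp, ih, Function.iterate_succ_apply']

theorem aeval_Pn {K E : Type*} [CommSemiring K] [CommSemiring E] [Algebra K E]
    (f g : Polynomial K) (n : ℕ) (x : E) :
    aeval x (Pn f g n) = aeval ((fun y => aeval y g)^[n] x) f := by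
  rw [Pn, aeval_comp, aeval_iterPoly]

theorem natDegree_iterPoly_s16 {K : Type*} [Field K] (g : Polynomial K) (n : ℕ) :
    (iterPoly g n).natDegree = g.natDegree ^ n := by
  induction n with
  | zero => simp [iterPoly]
  | succ n ih => rw [iterPoly, natDegree_comp, ih, pow_succ']

theorem natDegree_Pn_pos {K : Type*} [Field K] {f g : Polynomial K}
    (hf : 0 < f.natDegree) (hg : 0 < g.natDegree) (n : ℕ) : 0 < (Pn f g n).natDegree := by
  rw [Pn, natDegree_comp, natDegree_iterPoly_s16]
  positivity

theorem mfac_le_natDegree_minpoly {K E : Type*} [Field K] [Field E] [Algebra K E]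
    {P : Polynomial K} (hP : P ≠ 0) {x : E} (hx : aeval x P = 0) :
    mfac P ≤ (minpoly K x).natDegree := by
  have hi : IsIntegral K x := IsAlgebraic.isIntegral ⟨P, hP, hx⟩
  refine Nat.sInf_le ⟨minpoly K x, ?_, rfl⟩
  rw [irrFactors, Multiset.mem_toFinset, mem_normalizedFactors_iff' hP]
  exact ⟨minpoly.irreducible hi, (minpoly.monic hi).normalize_eq_self, minpoly.dvd K x hx⟩

theorem exists_irreducible_natDegree_eq_mfac {K : Type*} [Field K] {P : Polynomial K}
    (hP : 0 < P.natDegree) : ∃ r, Irreducible r ∧ r ∣ P ∧ r.natDegree = mfac P := by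
  have h0 : P ≠ 0 := ne_zero_of_natDegree_gt hP
  obtain ⟨q, hq⟩ := exists_mem_normalizedFactors h0 (not_isUnit_of_natDegree_pos P hP)
  obtain ⟨r, hr, hd⟩ := Nat.sInf_mem (s := {d | ∃ r ∈ irrFactors P, r.natDegree = d})
    ⟨_, q, Multiset.mem_toFinset.2 hq, rfl⟩
  rw [irrFactors, Multiset.mem_toFinset] at hr
  exact ⟨r, irreducible_of_normalized_factor r hr, dvd_of_mem_normalizedFactors hr, hd⟩

theorem associated_minpoly_of_irreducible {K E : Type*} [Field K] [Field E] [Algebra K E]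
    {f : Polynomial K} (hf : Irreducible f) {x : E} (hx : aeval x f = 0) :
    Associated (minpoly K x) f :=
  (minpoly.irreducible (IsAlgebraic.isIntegral ⟨f, hf.ne_zero, hx⟩)).associated_of_dvd hf
    (minpoly.dvd K x hx)

theorem natDegree_le_mfac_Pn {K : Type*} [Field K] {f g : Polynomial K} (hf : Irreducible f)
    (hg : 0 < g.natDegree) (n : ℕ) : f.natDegree ≤ mfac (Pn f g n) := by
  obtain ⟨r, hr, ⟨s, hs⟩, hd⟩ :=
    exists_irreducible_natDegree_eq_mfac (natDegree_Pn_pos hf.natDegree_pos hg n)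
  have := Fact.mk hr
  have : FiniteDimensional K (AdjoinRoot r) := (AdjoinRoot.powerBasis hr.ne_zero).finite
  have hx : aeval (AdjoinRoot.root r) (Pn f g n) = 0 := by
    rw [hs, map_mul, AdjoinRoot.aeval_eq, AdjoinRoot.mk_self, zero_mul]
  rw [aeval_Pn] at hx
  rw [← hd, ← natDegree_eq_of_degree_eq
    (degree_eq_degree_of_associated (associated_minpoly_of_irreducible hf hx))]
  refine (minpoly.natDegree_le _).trans_eq ?_
  rw [(AdjoinRoot.powerBasis hr.ne_zero).finrank, AdjoinRoot.powerBasis_dim]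

/-- In a finite set, the `n`-th iterate of any point is periodic once `n` reaches the size. -/
theorem exists_iterate_iterate_eq {E : Type*} [Finite E] (G : E → E) (x : E) {n : ℕ}
    (hn : Nat.card E ≤ n) : ∃ i, 1 ≤ i ∧ G^[i] (G^[n] x) = G^[n] x := by
  have := Fintype.ofFinite E
  obtain ⟨a, b, hab, h⟩ := Fintype.exists_ne_map_eq_of_card_lt
    (fun j : Fin (n + 1) => G^[j] x) (by rw [Fintype.card_fin, ← Nat.card_eq_fintype_card]; omega)
  wlog hlt : a < b generalizing a b
  · exact this b a hab.symm h.symm (lt_of_le_of_ne (not_lt.1 hlt) hab.symm)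
  have hlt' : (a : ℕ) < b := hlt
  have hb := b.isLt
  refine ⟨b - a, by omega, ?_⟩
  rw [← Function.iterate_add_apply, show (b : ℕ) - a + n = (n - a) + b by omega,
    Function.iterate_add_apply, ← h, ← Function.iterate_add_apply]
  congr 2
  omega

theorem exists_periodic_of_mfac_le {K L : Type*} [Field K] [Fintype K] [Field L] [Algebra K L]
    {f g : Polynomial K} (hf : Irreducible f) (hg : 0 < g.natDegree) {α : L} (hα : aeval α f = 0)
    {c : ℕ} (hc : mfac (Pn f g (Fintype.card K ^ c)) ≤ c) :
    ∃ i : ℕ, 1 ≤ i ∧ aeval α (iterPoly g i) = α := by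
  obtain ⟨r, hr, ⟨s, hs⟩, hd⟩ := exists_irreducible_natDegree_eq_mfac
    (natDegree_Pn_pos hf.natDegree_pos hg (Fintype.card K ^ c))
  have := Fact.mk hr
  have : FiniteDimensional K (AdjoinRoot r) := (AdjoinRoot.powerBasis hr.ne_zero).finite
  have : Finite (AdjoinRoot r) := Module.finite_of_finite K
  have hx : aeval (AdjoinRoot.root r) (Pn f g (Fintype.card K ^ c)) = 0 := by
    rw [hs, map_mul, AdjoinRoot.aeval_eq, AdjoinRoot.mk_self, zero_mul]
  rw [aeval_Pn] at hx
  have hcard : Nat.card (AdjoinRoot r) ≤ Fintype.card K ^ c := by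
    rw [Module.natCard_eq_pow_finrank (K := K), Nat.card_eq_fintype_card,
      (AdjoinRoot.powerBasis hr.ne_zero).finrank, AdjoinRoot.powerBasis_dim]
    exact Nat.pow_le_pow_right Fintype.card_pos (hd.trans_le hc)
  obtain ⟨i, hi, h⟩ := exists_iterate_iterate_eq (fun y => aeval y g) (AdjoinRoot.root r) hcard
  refine ⟨i, hi, ?_⟩
  have hdvd : f ∣ iterPoly g i - X := by
    refine (associated_minpoly_of_irreducible hf hx).symm.dvd.trans (minpoly.dvd K _ ?_)
    rw [map_sub, aeval_iterPoly, aeval_X, h, sub_self]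
  have h0 := aeval_eq_zero_of_dvd_aeval_eq_zero hdvd hα
  rwa [map_sub, aeval_X, sub_eq_zero] at h0

theorem mfac_Pn_eq_of_periodic {K L : Type*} [Field K] [Field L] [Algebra K L]
    [FiniteDimensional K L] {f g : Polynomial K} (hf : Irreducible f) (hg : 0 < g.natDegree)
    (hL : Module.finrank K L = f.natDegree) {α : L} (hα : aeval α f = 0)
    {i : ℕ} (hi : 1 ≤ i) (h : aeval α (iterPoly g i) = α) (n : ℕ) :
    mfac (Pn f g n) = f.natDegree := by
  refine le_antisymm ?_ (natDegree_le_mfac_Pn hf hg n)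
  rw [← hL]
  rw [aeval_iterPoly] at h
  have hroot : aeval ((fun y => aeval y g)^[i * n - n] α) (Pn f g n) = 0 := by
    rw [aeval_Pn, ← Function.iterate_add_apply,
      Nat.add_sub_cancel' (Nat.le_mul_of_pos_left n hi), Function.iterate_mul,
      Function.iterate_fixed h, hα]
  exact (mfac_le_natDegree_minpoly
    (ne_zero_of_natDegree_gt (natDegree_Pn_pos hf.natDegree_pos hg n)) hroot).trans
      (minpoly.natDegree_le _)

theorem stmt16 {K L : Type*} [Field K] [Fintype K] [Field L] [Fintype L] [Algebra K L]
    (f : Polynomial K) (k : ℕ) (hf : Irreducible f) (hk : f.natDegree = k) (hk1 : 1 ≤ k)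
    (hcard : Fintype.card L = Fintype.card K ^ k)
    (α : L) (hα : aeval α f = 0)
    (g : Polynomial K) (D : ℕ) (hgD : g.natDegree = D) (hD : 1 ≤ D) :
    ((∃ c : ℝ, 0 < c ∧ ∀ n : ℕ, (mfac (Pn f g n) : ℝ) ≤ c) ↔
      (∃ n₀ : ℕ, ∀ n : ℕ, n₀ ≤ n → mfac (Pn f g n) = mfac (Pn f g n₀))) ∧
    ((∃ n₀ : ℕ, ∀ n : ℕ, n₀ ≤ n → mfac (Pn f g n) = mfac (Pn f g n₀)) ↔
      (∃ i : ℕ, 1 ≤ i ∧ aeval α (iterPoly g i) = α)) ∧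
    ((∃ i : ℕ, 1 ≤ i ∧ aeval α (iterPoly g i) = α) ↔
      ∀ n : ℕ, mfac (Pn f g n) = k) := by
  have hg : 0 < g.natDegree := by omega
  have : FiniteDimensional K L := Module.Finite.of_finite
  have hL : Module.finrank K L = f.natDegree := by
    rw [Module.card_eq_pow_finrank (K := K)] at hcard
    rw [hk]
    exact Nat.pow_right_injective Fintype.one_lt_card hcard
  have h_bounded_periodic : (∃ c : ℝ, 0 < c ∧ ∀ n : ℕ, (mfac (Pn f g n) : ℝ) ≤ c) →
      ∃ i : ℕ, 1 ≤ i ∧ aeval α (iterPoly g i) = α := by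
    rintro ⟨c, -, hc⟩
    refine exists_periodic_of_mfac_le hf hg hα (c := ⌈c⌉₊) ?_
    exact_mod_cast (hc _).trans (Nat.le_ceil c)
  have h_periodic_const : (∃ i : ℕ, 1 ≤ i ∧ aeval α (iterPoly g i) = α) →
      ∀ n : ℕ, mfac (Pn f g n) = k := by
    rintro ⟨i, hi, h⟩ n
    rw [mfac_Pn_eq_of_periodic hf hg hL hα hi h, hk]
  have h_const_eventually : (∀ n : ℕ, mfac (Pn f g n) = k) →
      ∃ n₀ : ℕ, ∀ n : ℕ, n₀ ≤ n → mfac (Pn f g n) = mfac (Pn f g n₀) :=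
    fun h => ⟨0, fun n _ => by rw [h, h]⟩
  have h_eventually_bounded :
      (∃ n₀ : ℕ, ∀ n : ℕ, n₀ ≤ n → mfac (Pn f g n) = mfac (Pn f g n₀)) →
      ∃ c : ℝ, 0 < c ∧ ∀ n : ℕ, (mfac (Pn f g n) : ℝ) ≤ c := by
    rintro ⟨n₀, h⟩
    refine ⟨(((Finset.range (n₀ + 1)).sup fun n => mfac (Pn f g n)) + 1 : ℕ), by positivity,
      fun n => ?_⟩
    have hle : mfac (Pn f g n) ≤ (Finset.range (n₀ + 1)).sup fun n => mfac (Pn f g n) := by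
      rcases le_total n₀ n with hn | hn
      · rw [h n hn]
        exact Finset.le_sup (f := fun n => mfac (Pn f g n)) (by simp)
      · exact Finset.le_sup (f := fun n => mfac (Pn f g n)) (by simp; omega)
    exact_mod_cast hle.trans (Nat.le_succ _)
  exact ⟨⟨fun h => h_const_eventually (h_periodic_const (h_bounded_periodic h)),
      h_eventually_bounded⟩,
    ⟨fun h => h_bounded_periodic (h_eventually_bounded h),
      fun h => h_const_eventually (h_periodic_const h)⟩,
    ⟨h_periodic_const,
      fun h => h_bounded_periodic (h_eventually_bounded (h_const_eventually h))⟩⟩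
end

section
/- Let f ∈ F_q[x] be an irreducible polynomial of degree k, not of the form a·x, and let e = ord(f) be the least positive integer s such that f(x) divides x^s − 1. Let D > 1 be an integer with gcd(D, p) = 1 (p the characteristic of F_q), and write D = d₁·d₂ where gcd(d₁, e) = 1 and every prime factor of d₂ divides e. Let g(x) = x^D and let t be the number of distinct prime factors of d₁. Then there exist real constants c₁, …, c₆ > 0 such that for all n ≥ 1: c₁·D^n ≤ M_{f,g}(n) ≤ c₂·D^n, c₃·d₂^n ≤ m_{f,g}(n) ≤ c₄·d₂^n, and c₅·n^t ≤ N_{f,g}(n) ≤ c₆·n^t. -/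
open Polynomial UniqueFactorizationMonoid
open scoped Classical

theorem dvd_sub_one_mul_of_dvd_pow_sub_one {Q E s : ℕ} (hQ : 1 ≤ Q)
    (hE : ∀ r : ℕ, r.Prime → r ∣ E → r ∣ Q - 1) (hE₂ : 2 ∣ E → 4 ∣ Q - 1)
    (h : E ∣ Q ^ s - 1) : E ∣ (Q - 1) * s := by
  rw [Nat.dvd_iff_prime_pow_dvd_dvd]
  intro r i hr hri
  rcases Nat.eq_zero_or_pos i with rfl | hi
  · simp
  have hrE : r ∣ E := (dvd_pow_self r hi.ne').trans hri
  have hrQ : ¬ r ∣ Q := fun hd => hr.one_lt.ne'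
    (Nat.dvd_one.1 ((Nat.dvd_add_right (hE r hr hrE)).1 (by rwa [Nat.sub_add_cancel hQ])))
  have key : emultiplicity r (Q ^ s - 1 ^ s) = emultiplicity r (Q - 1) + emultiplicity r s := by
    rcases hr.eq_two_or_odd' with rfl | hodd
    · have h4 : (4 : ℤ) ∣ (Q : ℤ) - 1 := by
        have := Int.natCast_dvd_natCast.2 (hE₂ hrE)
        rwa [Nat.cast_sub hQ] at this
      have h2 : ¬ (2 : ℤ) ∣ (Q : ℤ) := by exact_mod_cast hrQ
      have := Int.two_pow_sub_pow' s h4 h2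
      rw [← Int.natCast_emultiplicity, ← Int.natCast_emultiplicity, ← Int.natCast_emultiplicity,
        Nat.cast_sub hQ, Nat.cast_sub (by simpa using Nat.one_le_pow s Q hQ)]
      simpa using this
    · exact Nat.emultiplicity_pow_sub_pow hr hodd (hE r hr hrE) hrQ s
  rw [pow_dvd_iff_le_emultiplicity, emultiplicity_mul hr.prime, ← key,
    ← pow_dvd_iff_le_emultiplicity, one_pow]
  exact hri.trans h

theorem exists_le_mul_of_dvd_pow_sub_one {q R : ℕ} (hq : 1 < q) (hR : R ≠ 0)
    (hqR : q.Coprime R) :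
    ∃ C : ℕ, 0 < C ∧ ∀ E s : ℕ, 0 < s → (∀ r : ℕ, r.Prime → r ∣ E → r ∣ R) →
      E ∣ q ^ s - 1 → E ≤ C * s := by
  have hφ : 0 < R.totient := Nat.totient_pos.2 (Nat.pos_of_ne_zero hR)
  have hQ : 1 < q ^ (R.totient * 2) := Nat.one_lt_pow (by positivity) hq
  have hRQ : R ∣ q ^ (R.totient * 2) - 1 := by
    have := (Nat.ModEq.pow_totient hqR).pow 2
    rw [← pow_mul, one_pow] at this
    exact (Nat.modEq_iff_dvd' hQ.le).1 this.symm
  refine ⟨q ^ (R.totient * 2) - 1, by omega, fun E s hs hE h => ?_⟩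
  refine Nat.le_of_dvd (Nat.mul_pos (by omega) hs) ?_
  refine dvd_sub_one_mul_of_dvd_pow_sub_one hQ.le (fun r hr hrE => (hE r hr hrE).trans hRQ)
    (fun h2 => ?_) (h.trans ?_)
  · have hodd : Odd q := by
      rw [← Nat.not_even_iff_odd, even_iff_two_dvd]
      intro h2q
      have := Nat.dvd_gcd h2q (hE 2 Nat.prime_two h2)
      rw [hqR] at this
      omega
    have := Nat.eight_dvd_sq_sub_one_of_odd (hodd.pow (n := R.totient))
    rw [← pow_mul] at this
    exact (by norm_num : 4 ∣ 8).trans this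
  · rw [← pow_mul, mul_comm, pow_mul]
    simpa using Nat.sub_dvd_pow_sub_pow (q ^ s) 1 (R.totient * 2)

theorem card_divisors_pow_bounds {d n : ℕ} (hd : d ≠ 0) (hn : 1 ≤ n) :
    n ^ d.primeFactors.card ≤ (d ^ n).divisors.card ∧
      (d ^ n).divisors.card ≤ d.divisors.card * n ^ d.primeFactors.card := by
  rw [Nat.card_divisors (pow_ne_zero n hd), Nat.card_divisors hd,
    Nat.primeFactors_pow d (by omega), ← Finset.prod_const, ← Finset.prod_mul_distrib]
  simp only [Nat.factorization_pow, Finsupp.smul_apply, smul_eq_mul]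
  refine ⟨Finset.prod_le_prod' fun r hr => ?_, Finset.prod_le_prod' fun r hr => ?_⟩
  · have : 0 < d.factorization r :=
      (Nat.prime_of_mem_primeFactors hr).factorization_pos_of_dvd hd
        (Nat.dvd_of_mem_primeFactors hr)
    nlinarith
  · nlinarith

theorem exists_eq_mul_of_div_gcd_eq {E a b e : ℕ} (ha : a ≠ 0) (hb : b ≠ 0)
    (hbe : ∀ r : ℕ, r.Prime → r ∣ b → r ∣ e)
    (h : E / E.gcd (a * b) = e) : ∃ j ∈ a.divisors, E = e * b * j := by
  set g := E.gcd (a * b) with hg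
  have hE : E = e * g := by rw [← h, Nat.div_mul_cancel (Nat.gcd_dvd_left _ _)]
  obtain ⟨c, hc⟩ : g ∣ a * b := Nat.gcd_dvd_right _ _
  have hg0 : 0 < g := Nat.pos_of_ne_zero fun h0 => by
    rw [h0, zero_mul] at hc
    exact mul_ne_zero ha hb hc
  have hce : e.Coprime c := by
    have : g * e.gcd c = g * 1 := by
      rw [← Nat.gcd_mul_left, mul_comm g e, ← hE, ← hc, mul_one]
    exact Nat.eq_of_mul_eq_mul_left hg0 this
  have hbc : b.Coprime c := Nat.Coprime.symm <| Nat.coprime_of_dvd fun r hr hrc hrb => by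
    have := Nat.dvd_gcd (hbe r hr hrb) hrc
    rw [hce] at this
    exact hr.one_lt.ne' (Nat.dvd_one.1 this)
  obtain ⟨j, hj⟩ : b ∣ g := hbc.dvd_of_dvd_mul_right (hc ▸ dvd_mul_left b a)
  refine ⟨j, Nat.mem_divisors.2 ⟨⟨c, ?_⟩, ha⟩, by rw [hE, hj, mul_assoc]⟩
  apply Nat.eq_of_mul_eq_mul_left (Nat.pos_of_ne_zero hb)
  rw [mul_comm b a, hc, hj, mul_assoc]

theorem exists_coprime_modEq {e E i : ℕ} (hE : E ≠ 0) (h : e ∣ E) (hi : i.Coprime e) :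
    ∃ i' : ℕ, i'.Coprime E ∧ i' ≡ i [MOD e] := by
  have : NeZero E := ⟨hE⟩
  obtain ⟨u, hu⟩ := ZMod.unitsMap_surjective h (ZMod.unitOfCoprime i hi)
  refine ⟨(u : ZMod E).val, ZMod.val_coe_unit_coprime u, ?_⟩
  rw [← ZMod.natCast_eq_natCast_iff]
  have := congrArg (Units.val) hu
  rw [ZMod.coe_unitOfCoprime, ZMod.unitsMap_val] at this
  rw [← this, ZMod.natCast_val]

section

variable {K : Type*} [Field K]

theorem iterPoly_X_pow (D n : ℕ) : iterPoly (X ^ D : K[X]) n = X ^ D ^ n := by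
  induction n with
  | zero => simp [iterPoly]
  | succ n ih => rw [iterPoly, ih, X_pow_comp, ← pow_mul, pow_succ]

theorem orderOf_root_dvd_iff {r : K[X]} {s : ℕ} :
    orderOf (AdjoinRoot.root r) ∣ s ↔ r ∣ X ^ s - 1 := by
  rw [orderOf_dvd_iff_pow_eq_one, ← AdjoinRoot.mk_eq_zero, map_sub, map_pow, AdjoinRoot.mk_X,
    map_one, sub_eq_zero]

theorem orderOf_eq_orderOf_root {L : Type*} [Field L] [Algebra K L] {r : K[X]}
    (hr : Irreducible r) {β : L} (h : aeval β r = 0) :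
    orderOf β = orderOf (AdjoinRoot.root r) := by
  have : Fact (Irreducible r) := ⟨hr⟩
  rw [aeval_def] at h
  have := orderOf_injective (AdjoinRoot.lift (algebraMap K L) β h : AdjoinRoot r →* L)
    (RingHom.injective _) (AdjoinRoot.root r)
  rwa [MonoidHom.coe_coe, AdjoinRoot.lift_root] at this

theorem mem_irrFactors {P r : K[X]} (hP : P ≠ 0) :
    r ∈ irrFactors P ↔ Irreducible r ∧ r.Monic ∧ r ∣ P := by
  rw [irrFactors, Multiset.mem_toFinset, mem_normalizedFactors_iff' hP]
  constructor
  · rintro ⟨h₁, h₂, h₃⟩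
    exact ⟨h₁, (normalize_eq_self_iff_monic h₁.ne_zero).1 h₂, h₃⟩
  · rintro ⟨h₁, h₂, h₃⟩
    exact ⟨h₁, (normalize_eq_self_iff_monic h₁.ne_zero).2 h₂, h₃⟩

theorem natDegree_le_orderOf_root {r : K[X]} (h : orderOf (AdjoinRoot.root r) ≠ 0) :
    r.natDegree ≤ orderOf (AdjoinRoot.root r) := by
  have := natDegree_le_of_dvd (orderOf_root_dvd_iff.1 (dvd_refl _))
    (X_pow_sub_C_ne_zero (Nat.pos_of_ne_zero h) (1 : K))
  rwa [← C_1, natDegree_X_pow_sub_C] at this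

theorem orderOf_root_dvd_card_pow_sub_one [Fintype K] {r : K[X]} (hr : Irreducible r)
    (h : orderOf (AdjoinRoot.root r) ≠ 0) :
    orderOf (AdjoinRoot.root r) ∣ Fintype.card K ^ r.natDegree - 1 := by
  have : Fact (Irreducible r) := ⟨hr⟩
  have := (AdjoinRoot.powerBasis hr.ne_zero).finite
  have := Module.finite_of_finite K (M := AdjoinRoot r)
  have := Fintype.ofFinite (AdjoinRoot r)
  have hcard : Fintype.card (AdjoinRoot r) = Fintype.card K ^ r.natDegree := by
    rw [Module.card_eq_pow_finrank (K := K), (AdjoinRoot.powerBasis hr.ne_zero).finrank,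
      AdjoinRoot.powerBasis_dim]
  rw [← hcard]
  apply orderOf_dvd_of_pow_eq_one
  apply FiniteField.pow_card_sub_one_eq_one
  intro h0
  rw [h0] at h
  exact h (orderOf_zero _)

theorem sum_natDegree_le_of_orderOf_root_eq {E : ℕ} (hE : 0 < E) (S : Finset K[X])
    (hS : ∀ r ∈ S, Irreducible r ∧ r.Monic ∧ orderOf (AdjoinRoot.root r) = E) :
    ∑ r ∈ S, r.natDegree ≤ E := by
  have hdvd : ∏ r ∈ S, r ∣ (X ^ E - C 1 : K[X]) := by
    refine Finset.prod_dvd_of_coprime (fun r hr s hs hrs => ?_) fun r hr =>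
      orderOf_root_dvd_iff.1 (hS r hr).2.2.dvd
    refine ((hS r hr).1.coprime_iff_not_dvd).2 fun hd => hrs ?_
    exact eq_of_monic_of_associated (hS r hr).2.1 (hS s hs).2.1
      ((hS r hr).1.associated_of_dvd (hS s hs).1 hd)
  have := natDegree_le_of_dvd hdvd (X_pow_sub_C_ne_zero hE (1 : K))
  rwa [natDegree_prod _ _ fun r hr => (hS r hr).1.ne_zero, natDegree_X_pow_sub_C] at this

variable {f : K[X]} {a b : ℕ}

theorem exists_orderOf_root_eq_of_dvd_comp_X_pow (hf : Irreducible f)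
    (ha : a ≠ 0) (hb : b ≠ 0)
    (hbe : ∀ r : ℕ, r.Prime → r ∣ b → r ∣ orderOf (AdjoinRoot.root f)) {r : K[X]}
    (hr : Irreducible r) (hdvd : r ∣ f.comp (X ^ (a * b))) :
    ∃ j ∈ a.divisors, orderOf (AdjoinRoot.root r) = orderOf (AdjoinRoot.root f) * b * j := by
  have : Fact (Irreducible r) := ⟨hr⟩
  have hroot : aeval (AdjoinRoot.root r ^ (a * b)) f = 0 := by
    have := AdjoinRoot.mk_eq_zero.2 hdvd
    rwa [← AdjoinRoot.aeval_eq, aeval_comp, map_pow, aeval_X] at this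
  refine exists_eq_mul_of_div_gcd_eq ha hb hbe ?_
  rw [← orderOf_pow' _ (mul_ne_zero ha hb), orderOf_eq_orderOf_root hf hroot]

theorem exists_dvd_comp_X_pow_orderOf_root_eq (hf : Irreducible f)
    {e : ℕ} (hfe : orderOf (AdjoinRoot.root f) = e) (he : 0 < e) (ha : a ≠ 0) (hb : b ≠ 0)
    (hK : ((e * b * a : ℕ) : K) ≠ 0)
    (hae : a.Coprime e) {j : ℕ} (hj : j ∣ a) :
    ∃ r : K[X], Irreducible r ∧ r.Monic ∧ r ∣ f.comp (X ^ (a * b)) ∧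
      orderOf (AdjoinRoot.root r) = e * b * j := by
  obtain ⟨α, hα⟩ : ∃ α : AlgebraicClosure K, aeval α f = 0 :=
    IsAlgClosed.exists_aeval_eq_zero (AlgebraicClosure K) f (degree_pos_of_irreducible hf).ne'
  have hαe : orderOf α = e := (orderOf_eq_orderOf_root hf hα).trans hfe
  obtain ⟨c, rfl⟩ := hj
  obtain ⟨hj0, hc0⟩ := mul_ne_zero_iff.1 ha
  have hE : e * b * j ≠ 0 := mul_ne_zero (mul_ne_zero he.ne' hb) hj0
  have : NeZero ((e * b * j : ℕ) : AlgebraicClosure K) := ⟨fun h0 => hK (by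
    rw [← map_natCast (algebraMap K (AlgebraicClosure K)), map_eq_zero] at h0
    rw [← mul_assoc, Nat.cast_mul, h0, zero_mul])⟩
  have : NeZero (e * b * j) := ⟨hE⟩
  obtain ⟨ξ, hξ⟩ := HasEnoughRootsOfUnity.exists_primitiveRoot (AlgebraicClosure K) (e * b * j)
  have hξe : orderOf (ξ ^ (j * c * b)) = e := by
    have hgcd : (e * b * j).gcd (j * c * b) = b * j := by
      rw [mul_assoc e, show j * c * b = c * (b * j) by ring, Nat.gcd_mul_right,
        Nat.Coprime.gcd_eq_one, one_mul]
      exact (Nat.Coprime.coprime_mul_left hae).symm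
    rw [orderOf_pow' _ (mul_ne_zero ha hb), ← hξ.eq_orderOf, hgcd, mul_assoc,
      Nat.mul_div_cancel _ (Nat.pos_of_ne_zero (mul_ne_zero hb hj0))]
  have : NeZero e := ⟨he.ne'⟩
  have hξ' : IsPrimitiveRoot (ξ ^ (j * c * b)) e := IsPrimitiveRoot.iff_orderOf.2 hξe
  obtain ⟨i, -, hi, hiα⟩ := hξ'.isPrimitiveRoot_iff.1 (IsPrimitiveRoot.iff_orderOf.2 hαe)
  obtain ⟨i', hi', hii'⟩ := exists_coprime_modEq hE (mul_assoc e b j ▸ dvd_mul_right e (b * j)) hi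
  have hβ : (ξ ^ i') ^ (j * c * b) = α := by
    rw [← hiα, ← pow_mul, mul_comm, pow_mul]
    exact pow_eq_pow_of_modEq hii' hξ'.pow_eq_one
  have hint : IsIntegral K (ξ ^ i') := Algebra.IsIntegral.isIntegral _
  refine ⟨minpoly K (ξ ^ i'), minpoly.irreducible hint, minpoly.monic hint, minpoly.dvd _ _ ?_, ?_⟩
  · rw [aeval_comp, map_pow, aeval_X, hβ, hα]
  · rw [← orderOf_eq_orderOf_root (minpoly.irreducible hint) (minpoly.aeval _ _)]
    exact ((hξ.pow_of_coprime i' hi').eq_orderOf).symm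

theorem Mfac_mfac_Nfac_comp_X_pow_bounds [Fintype K] (hf : Irreducible f)
    {e C : ℕ} (hfe : orderOf (AdjoinRoot.root f) = e) (he : 0 < e) (ha : a ≠ 0) (hb : b ≠ 0)
    (hbe : ∀ r : ℕ, r.Prime → r ∣ b → r ∣ e) (hae : a.Coprime e)
    (hK : ((e * b * a : ℕ) : K) ≠ 0)
    (hC : ∀ E s : ℕ, 0 < s → (∀ r : ℕ, r.Prime → r ∣ E → r ∣ e * b * a) →
      E ∣ Fintype.card K ^ s - 1 → E ≤ C * s) :
    (e * b * a ≤ C * Mfac (f.comp (X ^ (a * b))) ∧ Mfac (f.comp (X ^ (a * b))) ≤ e * b * a) ∧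
    (e * b ≤ C * mfac (f.comp (X ^ (a * b))) ∧ mfac (f.comp (X ^ (a * b))) ≤ e * b) ∧
    (a.divisors.card ≤ Nfac (f.comp (X ^ (a * b))) ∧
      Nfac (f.comp (X ^ (a * b))) ≤ C * a.divisors.card) := by
  set P := f.comp (X ^ (a * b)) with hPdef
  have hP : P ≠ 0 := by
    refine ne_zero_of_natDegree_gt (n := 0) ?_
    rw [hPdef, natDegree_comp, natDegree_X_pow]
    exact Nat.mul_pos hf.natDegree_pos (Nat.pos_of_ne_zero (mul_ne_zero ha hb))
  have hord : ∀ r ∈ irrFactors P, ∃ j ∈ a.divisors,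
      orderOf (AdjoinRoot.root r) = e * b * j := fun r hr => by
    obtain ⟨hirr, -, hdvd⟩ := (mem_irrFactors hP).1 hr
    simpa only [hfe] using exists_orderOf_root_eq_of_dvd_comp_X_pow hf ha hb
      (hfe ▸ hbe) hirr hdvd
  have hex : ∀ j ∈ a.divisors, ∃ r ∈ irrFactors P,
      orderOf (AdjoinRoot.root r) = e * b * j := fun j hj => by
    obtain ⟨r, h₁, h₂, h₃, h₄⟩ := exists_dvd_comp_X_pow_orderOf_root_eq hf hfe he ha hb hK hae
      (Nat.dvd_of_mem_divisors hj)
    exact ⟨r, (mem_irrFactors hP).2 ⟨h₁, h₂, h₃⟩, h₄⟩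
  have hpos : ∀ r ∈ irrFactors P, 0 < orderOf (AdjoinRoot.root r) := fun r hr => by
    obtain ⟨j, hj, h⟩ := hord r hr
    rw [h]
    have := Nat.pos_of_mem_divisors hj
    have := Nat.pos_of_ne_zero hb
    positivity
  have hle : ∀ r ∈ irrFactors P, r.natDegree ≤ orderOf (AdjoinRoot.root r) := fun r hr =>
    natDegree_le_orderOf_root (hpos r hr).ne'
  have hge : ∀ r ∈ irrFactors P, orderOf (AdjoinRoot.root r) ≤ C * r.natDegree := fun r hr => by
    have hirr := ((mem_irrFactors hP).1 hr).1
    obtain ⟨j, hj, h⟩ := hord r hr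
    refine hC _ _ hirr.natDegree_pos (fun s _ hs => hs.trans ?_)
      (orderOf_root_dvd_card_pow_sub_one hirr (hpos r hr).ne')
    rw [h]
    exact mul_dvd_mul_left _ (Nat.dvd_of_mem_divisors hj)
  have h1 : 1 ∈ a.divisors := Nat.one_mem_divisors.2 ha
  have haa : a ∈ a.divisors := Nat.mem_divisors_self a ha
  refine ⟨⟨?_, ?_⟩, ⟨?_, ?_⟩, ⟨?_, ?_⟩⟩
  · obtain ⟨r, hr, h⟩ := hex a haa
    rw [← h]
    exact (hge r hr).trans (Nat.mul_le_mul_left C (Finset.le_sup (f := natDegree) hr))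
  · refine Finset.sup_le fun r hr => (hle r hr).trans ?_
    obtain ⟨j, hj, h⟩ := hord r hr
    rw [h]
    exact Nat.mul_le_mul_left _ (Nat.divisor_le hj)
  · obtain ⟨r₀, hr₀, -⟩ := hex 1 h1
    obtain ⟨r, hr, h⟩ := Nat.sInf_mem (s := {d | ∃ r ∈ irrFactors P, r.natDegree = d})
      ⟨_, r₀, hr₀, rfl⟩
    obtain ⟨j, hj, hj'⟩ := hord r hr
    rw [mfac, ← h]
    refine le_trans ?_ (hge r hr)
    rw [hj']
    exact Nat.le_mul_of_pos_right _ (Nat.pos_of_mem_divisors hj)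
  · obtain ⟨r, hr, h⟩ := hex 1 h1
    rw [← mul_one (e * b), ← h]
    have : mfac P ≤ r.natDegree := Nat.sInf_le ⟨r, hr, rfl⟩
    exact this.trans (hle r hr)
  · refine Finset.card_le_card_of_surjOn (fun r => orderOf (AdjoinRoot.root r) / (e * b)) ?_
    intro j hj
    obtain ⟨r, hr, h⟩ := hex j hj
    refine ⟨r, hr, ?_⟩
    simp only [h]
    exact Nat.mul_div_cancel_left j (Nat.mul_pos he (Nat.pos_of_ne_zero hb))
  · have himg : (irrFactors P).image (fun r => orderOf (AdjoinRoot.root r)) ⊆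
        a.divisors.image (fun j => e * b * j) := by
      intro E hE
      obtain ⟨r, hr, rfl⟩ := Finset.mem_image.1 hE
      obtain ⟨j, hj, h⟩ := hord r hr
      exact Finset.mem_image.2 ⟨j, hj, h.symm⟩
    refine (Finset.card_le_mul_card_image (irrFactors P) C fun E hE => ?_).trans
      (Nat.mul_le_mul_left C ((Finset.card_le_card himg).trans Finset.card_image_le))
    obtain ⟨r₀, hr₀, hE'⟩ := Finset.mem_image.1 hE
    have hE0 : 0 < E := hE' ▸ hpos r₀ hr₀
    set S := (irrFactors P).filter fun r => orderOf (AdjoinRoot.root r) = E with hS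
    have hsum := sum_natDegree_le_of_orderOf_root_eq hE0 S fun r hr => by
      obtain ⟨hr, h⟩ := Finset.mem_filter.1 hr
      obtain ⟨hirr, hmon, -⟩ := (mem_irrFactors hP).1 hr
      exact ⟨hirr, hmon, h⟩
    have hcard : S.card * E ≤ ∑ r ∈ S, C * r.natDegree := by
      rw [← smul_eq_mul]
      refine Finset.card_nsmul_le_sum _ _ _ fun r hr => ?_
      obtain ⟨hr, h⟩ := Finset.mem_filter.1 hr
      exact h ▸ hge r hr
    rw [← Finset.mul_sum] at hcard
    exact Nat.le_of_mul_le_mul_right (hcard.trans (Nat.mul_le_mul_left C hsum)) hE0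

end

theorem stmt18 {K : Type*} [Field K] [Fintype K] {p : ℕ} [Fact p.Prime] [CharP K p]
    (f : Polynomial K) (k : ℕ) (hf : Irreducible f) (hk : f.natDegree = k)
    (hform : ¬ ∃ a : K, f = C a * X)
    (e : ℕ) (he : 0 < e) (hdiv : f ∣ X ^ e - 1)
    (hmin : ∀ s : ℕ, 0 < s → f ∣ X ^ s - 1 → e ≤ s)
    (D d₁ d₂ : ℕ) (hD : 1 < D) (hDp : ¬ p ∣ D) (hDd : D = d₁ * d₂)
    (hd₁ : Nat.Coprime d₁ e) (hd₂ : ∀ r : ℕ, r.Prime → r ∣ d₂ → r ∣ e)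
    (t : ℕ) (ht : t = d₁.primeFactors.card) :
    ∃ c₁ c₂ c₃ c₄ c₅ c₆ : ℝ,
      0 < c₁ ∧ 0 < c₂ ∧ 0 < c₃ ∧ 0 < c₄ ∧ 0 < c₅ ∧ 0 < c₆ ∧
      ∀ n : ℕ, 1 ≤ n →
        (c₁ * (D : ℝ) ^ n ≤ (Mfac (Pn f (X ^ D) n) : ℝ) ∧
          (Mfac (Pn f (X ^ D) n) : ℝ) ≤ c₂ * (D : ℝ) ^ n) ∧
        (c₃ * (d₂ : ℝ) ^ n ≤ (mfac (Pn f (X ^ D) n) : ℝ) ∧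
          (mfac (Pn f (X ^ D) n) : ℝ) ≤ c₄ * (d₂ : ℝ) ^ n) ∧
        (c₅ * (n : ℝ) ^ t ≤ (Nfac (Pn f (X ^ D) n) : ℝ) ∧
          (Nfac (Pn f (X ^ D) n) : ℝ) ≤ c₆ * (n : ℝ) ^ t) := by
  subst hk ht
  have hfe : orderOf (AdjoinRoot.root f) = e := by
    have hdvd := orderOf_root_dvd_iff.2 hdiv
    have hpos := Nat.pos_of_dvd_of_pos hdvd he
    exact le_antisymm (Nat.le_of_dvd he hdvd) (hmin _ hpos (orderOf_root_dvd_iff.1 dvd_rfl))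
  have hD0 : d₁ ≠ 0 ∧ d₂ ≠ 0 := mul_ne_zero_iff.1 (by omega)
  have hp : p.Prime := Fact.out
  obtain ⟨m, -, hm⟩ := FiniteField.card K p
  have hpe : ¬ p ∣ e := fun h => by
    have hpow : p ∣ Fintype.card K ^ f.natDegree := by
      rw [hm, ← pow_mul]
      exact dvd_pow_self p (Nat.mul_pos m.pos hf.natDegree_pos).ne'
    have hsub : p ∣ Fintype.card K ^ f.natDegree - 1 :=
      h.trans (hfe ▸ orderOf_root_dvd_card_pow_sub_one hf (hfe ▸ he.ne'))
    have hone : 1 ≤ Fintype.card K ^ f.natDegree := Nat.one_le_pow _ _ Fintype.card_pos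
    rw [← Nat.sub_add_cancel hone] at hpow
    exact hp.one_lt.ne' (Nat.dvd_one.1 ((Nat.dvd_add_right hsub).1 hpow))
  obtain ⟨C, hC0, hC⟩ := exists_le_mul_of_dvd_pow_sub_one (q := Fintype.card K) (R := e * D)
    Fintype.one_lt_card (mul_ne_zero he.ne' (by omega)) (by
      rw [hm]
      exact Nat.Coprime.pow_left _ (((hp.coprime_iff_not_dvd).2 hpe).mul_right
        ((hp.coprime_iff_not_dvd).2 hDp)))
  have hCpos : (0 : ℝ) < C := Nat.cast_pos.2 hC0
  have hepos : (0 : ℝ) < e := Nat.cast_pos.2 he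
  have hdpos : 0 < d₁.divisors.card := Finset.card_pos.2 ⟨1, Nat.one_mem_divisors.2 hD0.1⟩
  refine ⟨e / C, e, e / C, e, 1, C * d₁.divisors.card, by positivity, hepos, by positivity, hepos,
    one_pos, by positivity, fun n hn => ?_⟩
  have hDn : D ^ n = d₁ ^ n * d₂ ^ n := by rw [hDd, mul_pow]
  have hprod : e * d₂ ^ n * d₁ ^ n = e * D ^ n := by rw [hDn]; ring
  have hprime : ∀ r : ℕ, r.Prime → r ∣ e * D ^ n → r ∣ e * D := fun r hr h =>
    (hr.dvd_mul.1 h).elim (fun h => h.mul_right D) fun h => (hr.dvd_of_dvd_pow h).mul_left e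
  have hP : Pn f (X ^ D) n = f.comp (X ^ (d₁ ^ n * d₂ ^ n)) := by
    rw [Pn, iterPoly_X_pow, hDn]
  obtain ⟨⟨hM₁, hM₂⟩, ⟨hm₁, hm₂⟩, ⟨hN₁, hN₂⟩⟩ := Mfac_mfac_Nfac_comp_X_pow_bounds (C := C) hf hfe
    he (pow_ne_zero n hD0.1) (pow_ne_zero n hD0.2)
    (fun r hr h => hd₂ r hr (hr.dvd_of_dvd_pow h)) (hd₁.pow_left n)
    (by
      rw [hprod, Ne, CharP.cast_eq_zero_iff K p]
      exact fun h => ((hp.dvd_mul.1 (hprime p hp h)).elim hpe hDp))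
    (fun E s hs hE h => hC E s hs
      (fun r hr hrE => hprime r hr (hprod ▸ hE r hr hrE)) h)
  rw [← hP] at hM₁ hM₂ hm₁ hm₂ hN₁ hN₂
  rw [hprod] at hM₁ hM₂
  obtain ⟨hτ₁, hτ₂⟩ := card_divisors_pow_bounds hD0.1 hn
  refine ⟨⟨?_, by exact_mod_cast hM₂⟩, ⟨?_, by exact_mod_cast hm₂⟩, ?_, ?_⟩
  · rw [div_mul_eq_mul_div, div_le_iff₀' hCpos]
    exact_mod_cast hM₁
  · rw [div_mul_eq_mul_div, div_le_iff₀' hCpos]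
    exact_mod_cast hm₁
  · rw [one_mul]
    exact_mod_cast hτ₁.trans hN₁
  · rw [mul_assoc]
    exact_mod_cast hN₂.trans (Nat.mul_le_mul_left C hτ₂)
end
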